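/- Let r ≥ 2, set m = 2^r − 1 and n = 2m = 2^{r+1} − 2, and let s = 2σ be an even integer with 4 ≤ s ≤ n (equivalently 2 ≤ σ ≤ m). Let D be the free abelian group with basis {[w] : w ∈ ℕ^{s−1}}, with the ℤ-linear map ∂ : D → D given on basis elements by ∂[w] = Σ_{t=1}^{s−1} c_t(w)·[w − e_t], where e_t is the t-th standard basis vector, [w − e_t] is interpreted as 0 when w_t = 0, and c_t(w) = −2·(−1)^{w_1 + ⋯ + w_{t−1}} if t is odd and w_t is odd, c_t(w) = 2·(−1)^{w_1 + ⋯ + w_{t−1}} if t is even and w_t is even, and c_t(w) = 0 otherwise. Define z ∈ D as the sum, over all tuples δ = (δ_1, …, δ_{s−2}) ∈ {0,1}^{s−2} with δ_i·δ_{i+1} = 0 for all 1 ≤ i ≤ s−3, and over all tuples of natural numbers (p_1, …, p_{s−2}) and (q_1, …, q_{s−2}) with p_i + q_i = m − δ_i for every i, of the term (−1)^{δ_2 + δ_4 + ⋯ + δ_{s−2}} · C(m + p_1, p_1) · (Π_{i=1}^{s−3} C(q_i + p_{i+1}, p_{i+1})) · C(q_{s−2} + m, m) · [w(δ,p,q)],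 where w(δ,p,q) = (n + 2p_1 + δ_1, 2(q_1 + p_2) + δ_1 + δ_2, 2(q_2 + p_3) + δ_2 + δ_3, …, 2(q_{s−3} + p_{s−2}) + δ_{s−3} + δ_{s−2}, n + 2q_{s−2} + δ_{s−2}) ∈ ℕ^{s−1}. Then z lies in the image of ∂, i.e. z ∈ ∂(D). -/

import Mathlib

/-- The sign `(-1)^{w_1 + ⋯ + w_{t-1}}` appearing in the differential of the complex `𝒟_•`. -/
def dSign (n : ℕ) (w : Fin n → ℕ) (t : Fin n) : ℤ :=
  (-1) ^ (∑ j ∈ Finset.univ.filter (fun j : Fin n => j < t), w j)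

/-- The coefficient `c_t(w)`: with 1-indexed coordinates (so the `t`-th coordinate,
`1 ≤ t ≤ n`, corresponds to the index `t - 1 : Fin n`), it is
`-2·(-1)^{w_1+⋯+w_{t-1}}` if `t` is odd and `w_t` is odd,
`2·(-1)^{w_1+⋯+w_{t-1}}` if `t` is even and `w_t` is even, and `0` otherwise. -/
def dCoeff (n : ℕ) (w : Fin n → ℕ) (t : Fin n) : ℤ :=
  if t.1 % 2 = 0 then (if Odd (w t) then -2 * dSign n w t else 0)
  else (if Even (w t) then 2 * dSign n w t else 0)

/-- The summand `c_t(w)·[w - e_t]` of `∂[w]`, interpreted as `0` when `w_t = 0`. -/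
noncomputable def dTerm (n : ℕ) (w : Fin n → ℕ) (t : Fin n) : (Fin n → ℕ) →₀ ℤ :=
  if w t = 0 then 0
  else Finsupp.single (Function.update w t (w t - 1)) (dCoeff n w t)

/-- The differential `∂` of the free abelian group `D` with basis `{[w] : w ∈ ℕ^n}`:
`∂[w] = Σ_t c_t(w)·[w - e_t]`, extended `ℤ`-linearly. -/
noncomputable def bd (n : ℕ) : ((Fin n → ℕ) →₀ ℤ) →ₗ[ℤ] ((Fin n → ℕ) →₀ ℤ) :=
  Finsupp.lsum ℤ fun w => LinearMap.toSpanSingleton ℤ _ (∑ t, dTerm n w t)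

/-- A summation index `x : Fin (s-2) → Fin 2 × Fin (m+1)` encodes the tuples
`δ = (δ_1, ..., δ_{s-2}) ∈ {0,1}^{s-2}` and `p = (p_1, ..., p_{s-2})` (1-indexed);
`dOf s m x i` is `δ_i` for `1 ≤ i ≤ s-2` and `0` otherwise. -/
def dOf (s m : ℕ) (x : Fin (s - 2) → Fin 2 × Fin (m + 1)) (i : ℕ) : ℕ :=
  if h : 1 ≤ i ∧ i ≤ s - 2 then ((x ⟨i - 1, by omega⟩).1 : ℕ) else 0

/-- `pOf s m x i` is `p_i` for `1 ≤ i ≤ s-2` and `0` otherwise. -/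
def pOf (s m : ℕ) (x : Fin (s - 2) → Fin 2 × Fin (m + 1)) (i : ℕ) : ℕ :=
  if h : 1 ≤ i ∧ i ≤ s - 2 then ((x ⟨i - 1, by omega⟩).2 : ℕ) else 0

/-- `qOf s m x i = q_i`, determined by `q_i = m - δ_i - p_i`. -/
def qOf (s m : ℕ) (x : Fin (s - 2) → Fin 2 × Fin (m + 1)) (i : ℕ) : ℕ :=
  m - dOf s m x i - pOf s m x i

/-- The 1-indexed coordinates of the basis vector `w(δ,p,q) ∈ ℕ^{s-1}` (with `n = 2m`):
`w_1 = n + 2p_1 + δ_1`, `w_j = 2(q_{j-1} + p_j) + δ_{j-1} + δ_j` for `2 ≤ j ≤ s-2`,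
and `w_{s-1} = n + 2q_{s-2} + δ_{s-2}`. -/
def wOf (s m : ℕ) (x : Fin (s - 2) → Fin 2 × Fin (m + 1)) (j : ℕ) : ℕ :=
  if j = 1 then 2 * m + 2 * pOf s m x 1 + dOf s m x 1
  else if j = s - 1 then 2 * m + 2 * qOf s m x (s - 2) + dOf s m x (s - 2)
  else 2 * (qOf s m x (j - 1) + pOf s m x j) + dOf s m x (j - 1) + dOf s m x j

/-- The sign `(-1)^{δ_2 + δ_4 + ⋯ + δ_{s-2}}`. -/
def signOf (s m : ℕ) (x : Fin (s - 2) → Fin 2 × Fin (m + 1)) : ℤ :=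
  (-1) ^ (∑ j ∈ (Finset.Icc 1 (s - 2)).filter (fun j => j % 2 = 0), dOf s m x j)

/-- The product of binomial coefficients
`C(m + p_1, p_1) · (Π_{i=1}^{s-3} C(q_i + p_{i+1}, p_{i+1})) · C(q_{s-2} + m, m)`. -/
def coefOf (s m : ℕ) (x : Fin (s - 2) → Fin 2 × Fin (m + 1)) : ℕ :=
  Nat.choose (m + pOf s m x 1) (pOf s m x 1) *
    (∏ i ∈ Finset.Icc 1 (s - 3), Nat.choose (qOf s m x i + pOf s m x (i + 1)) (pOf s m x (i + 1))) *
    Nat.choose (qOf s m x (s - 2) + m) m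

/-- Admissibility of an index tuple: `δ_i·δ_{i+1} = 0` for all `1 ≤ i ≤ s-3` (no two
consecutive `δ`'s equal to `1`) and `p_i + q_i = m - δ_i` for all `1 ≤ i ≤ s-2`. -/
def zpred (s m : ℕ) (x : Fin (s - 2) → Fin 2 × Fin (m + 1)) : Prop :=
  (∀ i ∈ Finset.Icc 1 (s - 3), dOf s m x i * dOf s m x (i + 1) = 0) ∧
  (∀ i ∈ Finset.Icc 1 (s - 2), pOf s m x i + qOf s m x i = m - dOf s m x i)

instance (s m : ℕ) : DecidablePred (zpred s m) := fun _ => by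
  unfold zpred; infer_instance

/-- The chain `z ∈ D`: the sum over all tuples `δ ∈ {0,1}^{s-2}` with no two consecutive
entries equal to `1` and all tuples `p, q` of naturals with `p_i + q_i = m - δ_i`, of
`(-1)^{δ_2+δ_4+⋯+δ_{s-2}} · C(m+p_1,p_1) · (Π C(q_i+p_{i+1},p_{i+1})) · C(q_{s-2}+m,m) · [w(δ,p,q)]`. -/
noncomputable def zchain (s m : ℕ) : (Fin (s - 1) → ℕ) →₀ ℤ :=
  ∑ x ∈ Finset.univ.filter (zpred s m),
    (signOf s m x * (coefOf s m x : ℤ)) • Finsupp.single (fun i : Fin (s - 1) => wOf s m x (i.1 + 1)) 1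

/-- Product of two basis elements of the resolution: the structure constant of `[b] · [a]`. -/
def mulCoeff (b a : ℕ) : ℤ := if Odd b ∧ Odd a then 0 else ((b / 2 + a / 2).choose (a / 2) : ℤ)

/-- Unsigned coefficient of the `t`-th partial differential on a coordinate equal to `w`. -/
def partialCoeff (t w : ℕ) : ℤ :=
  if t % 2 = 0 then (if Odd w then -2 else 0) else (if Even w ∧ w ≠ 0 then 2 else 0)

lemma partialCoeff_zero (t : ℕ) : partialCoeff t 0 = 0 := by
  simp [partialCoeff]

lemma partialCoeff_add_mul_mulCoeff (t b a : ℕ) :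
    partialCoeff t (b + a) * mulCoeff b a =
      partialCoeff t b * mulCoeff (b - 1) a +
        (-1) ^ b * partialCoeff t a * mulCoeff b (a - 1) := by
  rcases Nat.even_or_odd' b with ⟨k, rfl | rfl⟩ <;> rcases Nat.even_or_odd' a with ⟨l, rfl | rfl⟩
  · rcases k with _ | k <;> rcases l with _ | l
    · simp [partialCoeff, mulCoeff]
    · have h1 : (2 * (l + 1) - 1) / 2 = l := by omega
      simp [partialCoeff, mulCoeff, h1, ← Nat.not_even_iff_odd]
    · have h1 : (2 * (k + 1) - 1) / 2 = k := by omega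
      simp [partialCoeff, mulCoeff, h1, ← Nat.not_even_iff_odd]
    · have h1 : (2 * (k + 1) - 1) / 2 = k := by omega
      have h2 : (2 * (l + 1) - 1) / 2 = l := by omega
      have h3 : k + 1 + (l + 1) = (k + (l + 1)) + 1 := by omega
      have h4 : k + 1 + l = k + (l + 1) := by omega
      have h5 : (-1 : ℤ) ^ (2 * (k + 1)) = 1 := by simp [pow_mul]
      simp only [partialCoeff, mulCoeff, h1, h2, h5, ← Nat.not_even_iff_odd]
      simp [Nat.even_add, h3, h4, Nat.choose_succ_succ]
      split_ifs <;> ring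
  · have h1 : (2 * l + 1) / 2 = l := by omega
    have h5 : (-1 : ℤ) ^ (2 * k) = 1 := by simp [pow_mul]
    rcases k with _ | k
    · simp [partialCoeff, mulCoeff, h1, ← Nat.not_even_iff_odd]
    · have ho : Odd (2 * (k + 1) - 1) := ⟨k, by omega⟩
      have ho' : Odd (2 * l + 1) := ⟨l, rfl⟩
      rw [mulCoeff, mulCoeff, if_pos (And.intro ho ho'), h5]
      simp [partialCoeff, mulCoeff, h1, Nat.even_add, ← Nat.not_even_iff_odd]
  · have h1 : (2 * k + 1) / 2 = k := by omega
    have h5 : (-1 : ℤ) ^ (2 * k + 1) = -1 := by simp [pow_succ, pow_mul]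
    rcases l with _ | l
    · simp [partialCoeff, mulCoeff, h1, ← Nat.not_even_iff_odd]
    · have ho : Odd (2 * (l + 1) - 1) := ⟨l, by omega⟩
      have ho' : Odd (2 * k + 1) := ⟨k, rfl⟩
      have hz : mulCoeff (2 * k + 1) (2 * (l + 1) - 1) = 0 := if_pos ⟨ho', ho⟩
      rw [hz]
      simp [partialCoeff, mulCoeff, h1, Nat.even_add, ← Nat.not_even_iff_odd]
  · have h1 : (2 * k + 1) / 2 = k := by omega
    have h2 : (2 * l + 1) / 2 = l := by omega
    have h5 : (-1 : ℤ) ^ (2 * k + 1) = -1 := by simp [pow_succ, pow_mul]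
    rw [h5]
    simp [partialCoeff, mulCoeff, h1, h2, Nat.even_add, ← Nat.not_even_iff_odd]
    split_ifs <;> ring

lemma dTerm_eq_single (n : ℕ) (w : Fin n → ℕ) (t : Fin n) :
    dTerm n w t =
      Finsupp.single (Function.update w t (w t - 1)) (dSign n w t * partialCoeff t (w t)) := by
  unfold dTerm dCoeff partialCoeff
  by_cases h : w t = 0
  · simp [h]
  · rw [if_neg h]
    congr 1
    split_ifs <;> simp_all [mul_comm]

lemma bd_single (n : ℕ) (w : Fin n → ℕ) (c : ℤ) :
    bd n (Finsupp.single w c) = c • ∑ t, dTerm n w t := by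
  simp [bd]

/-- The product of `⊗ [b_t]` and `⊗ [a_t]`, taken factor by factor. -/
noncomputable def tensorMul (n : ℕ) (b a : Fin n → ℕ) : (Fin n → ℕ) →₀ ℤ :=
  Finsupp.single (b + a) (∏ t, mulCoeff (b t) (a t))

lemma partialCoeff_smul_tensorMul_left (n : ℕ) (b a : Fin n → ℕ) (t : Fin n) :
    partialCoeff t (b t) • tensorMul n (Function.update b t (b t - 1)) a =
      Finsupp.single (Function.update (b + a) t ((b + a) t - 1))
        (partialCoeff t (b t) * mulCoeff (b t - 1) (a t) *
          ∏ j ∈ Finset.univ.erase t, mulCoeff (b j) (a j)) := by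
  by_cases h : b t = 0
  · simp [h, partialCoeff_zero]
  · rw [tensorMul, Finsupp.smul_single, smul_eq_mul, mul_assoc,
      ← Finset.mul_prod_erase _ _ (Finset.mem_univ t)]
    congr 1
    · ext j
      rcases eq_or_ne j t with rfl | hj
      · simp; omega
      · simp [hj]
    · simp only [Function.update_self]
      congr 2
      refine Finset.prod_congr rfl fun j hj => ?_
      rw [Function.update_of_ne (Finset.ne_of_mem_erase hj)]

lemma partialCoeff_smul_tensorMul_right (n : ℕ) (b a : Fin n → ℕ) (t : Fin n) :
    partialCoeff t (a t) • tensorMul n b (Function.update a t (a t - 1)) =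
      Finsupp.single (Function.update (b + a) t ((b + a) t - 1))
        (partialCoeff t (a t) * mulCoeff (b t) (a t - 1) *
          ∏ j ∈ Finset.univ.erase t, mulCoeff (b j) (a j)) := by
  by_cases h : a t = 0
  · simp [h, partialCoeff_zero]
  · rw [tensorMul, Finsupp.smul_single, smul_eq_mul, mul_assoc,
      ← Finset.mul_prod_erase _ _ (Finset.mem_univ t)]
    congr 1
    · ext j
      rcases eq_or_ne j t with rfl | hj
      · simp; omega
      · simp [hj]
    · simp only [Function.update_self]
      congr 2
      refine Finset.prod_congr rfl fun j hj => ?_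
      rw [Function.update_of_ne (Finset.ne_of_mem_erase hj)]

/-- Leibniz rule for the differential. -/
lemma bd_tensorMul (n : ℕ) (b a : Fin n → ℕ) :
    bd n (tensorMul n b a) = ∑ t : Fin n, dSign n (b + a) t •
      (partialCoeff t (b t) • tensorMul n (Function.update b t (b t - 1)) a +
        (-1 : ℤ) ^ b t •
          partialCoeff t (a t) • tensorMul n b (Function.update a t (a t - 1))) := by
  conv_lhs => rw [tensorMul, bd_single, Finset.smul_sum]
  refine Finset.sum_congr rfl fun t _ => ?_
  rw [partialCoeff_smul_tensorMul_left, partialCoeff_smul_tensorMul_right, dTerm_eq_single,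
    Finsupp.smul_single, Finsupp.smul_single, ← Finsupp.single_add, Finsupp.smul_single]
  congr 1
  have h := partialCoeff_add_mul_mulCoeff t (b t) (a t)
  rw [← Finset.mul_prod_erase _ _ (Finset.mem_univ t)]
  simp only [smul_eq_mul, Pi.add_apply]
  linear_combination (dSign n (b + a) t * ∏ j ∈ Finset.univ.erase t, mulCoeff (b j) (a j)) * h

/-- Contraction of the complex in its first coordinate, up to a factor of two. -/
noncomputable def contraction (k : ℕ) : ((Fin (k + 1) → ℕ) →₀ ℤ) →ₗ[ℤ] ((Fin (k + 1) → ℕ) →₀ ℤ) :=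
  Finsupp.lsum ℤ fun w => LinearMap.toSpanSingleton ℤ _
    (if Even (w 0) then -Finsupp.single (Function.update w 0 (w 0 + 1)) 1 else 0)

lemma contraction_single (k : ℕ) (w : Fin (k + 1) → ℕ) (c : ℤ) :
    contraction k (Finsupp.single w c) =
      if Even (w 0) then -Finsupp.single (Function.update w 0 (w 0 + 1)) c else 0 := by
  simp only [contraction, Finsupp.lsum_single, LinearMap.toSpanSingleton_apply]
  split_ifs <;> simp

lemma dSign_succ_update (k : ℕ) (w : Fin (k + 1) → ℕ) (t : Fin k) :
    dSign (k + 1) (Function.update w 0 (w 0 + 1)) t.succ = -dSign (k + 1) w t.succ := by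
  have h0 : (0 : Fin (k + 1)) ∈ Finset.univ.filter (fun j => j < t.succ) := by
    simp
  rw [dSign, dSign, ← Finset.add_sum_erase _ _ h0, ← Finset.add_sum_erase _ w h0,
    Function.update_self]
  rw [Finset.sum_congr rfl fun j hj => Function.update_of_ne (Finset.ne_of_mem_erase hj) _ _]
  ring

lemma bd_contraction_add_contraction_bd (k : ℕ) (y : (Fin (k + 1) → ℕ) →₀ ℤ) :
    bd (k + 1) (contraction k y) + contraction k (bd (k + 1) y) = (2 : ℤ) • y := by
  induction y using Finsupp.induction_linear with
  | zero => simp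
  | add f g hf hg =>
    simp only [map_add, smul_add]
    rw [← hf, ← hg]
    abel
  | single w c =>
    have hs : dSign (k + 1) w 0 = 1 := by simp [dSign]
    have hs' (v) : dSign (k + 1) (Function.update w 0 v) 0 = 1 := by simp [dSign]
    rw [contraction_single, bd_single, map_smul, map_sum]
    by_cases h : Even (w 0)
    · simp only [if_pos h, map_neg, bd_single, Fin.sum_univ_succ, dTerm_eq_single,
        contraction_single, dSign_succ_update]
      have h' : Odd (w 0 + 1) := h.add_one
      simp only [Function.update_self, Function.update_of_ne (Fin.succ_ne_zero _), hs, hs',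
        Function.update_of_ne (Fin.succ_ne_zero _).symm, if_pos h]
      have hp : partialCoeff ((0 : Fin (k + 1)) : ℕ) (w 0 + 1) = -2 := by
        simp [partialCoeff, h']
      have hp' : partialCoeff ((0 : Fin (k + 1)) : ℕ) (w 0) = 0 := by
        simp [partialCoeff, h]
      rw [hp, hp']
      simp only [mul_zero, Finsupp.single_zero, neg_zero, ite_self, zero_add, smul_add,
        Finset.smul_sum, Finsupp.smul_single, Finset.sum_neg_distrib, smul_neg, neg_mul,
        Finsupp.single_neg]
      rw [Finset.sum_congr rfl fun t _ => by
        rw [Function.update_comm (Fin.succ_ne_zero t).symm]]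
      simp [mul_comm]
    · have ho : Odd (w 0) := Nat.not_even_iff_odd.mp h
      simp only [if_neg h, map_zero, zero_add, Fin.sum_univ_succ, dTerm_eq_single,
        contraction_single]
      simp only [Function.update_self, hs, Function.update_of_ne (Fin.succ_ne_zero _).symm, if_neg h]
      have hp : partialCoeff ((0 : Fin (k + 1)) : ℕ) (w 0) = -2 := by
        simp [partialCoeff, ho]
      have he : Even (w 0 - 1) := by
        obtain ⟨j, hj⟩ := ho
        exact ⟨j, by omega⟩
      have hw : w 0 - 1 + 1 = w 0 := Nat.succ_pred_eq_of_pos ho.pos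
      rw [hp, if_pos he, hw]
      simp [mul_comm]

/-- A cycle with even coefficients is a boundary. -/
lemma exists_bd_eq (k : ℕ) (z : (Fin (k + 1) → ℕ) →₀ ℤ) (hz : bd (k + 1) z = 0)
    (he : ∃ y, z = (2 : ℤ) • y) : ∃ y, bd (k + 1) y = z := by
  obtain ⟨y, rfl⟩ := he
  refine ⟨contraction k y, ?_⟩
  rw [map_smul] at hz
  have hy : bd (k + 1) y = 0 := (smul_eq_zero.mp hz).resolve_left two_ne_zero
  simpa [hy] using bd_contraction_add_contraction_bd k y

/-- The complementary degrees `n - a_t`, where `a_t` runs over all but the last entry. -/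
def leftDeg {k : ℕ} (n : ℕ) (a : Fin (k + 2) → ℕ) : Fin (k + 1) → ℕ := fun t => n - a t.castSucc

/-- The degrees `a_t`, where `a_t` runs over all but the first entry. -/
def rightDeg {k : ℕ} (a : Fin (k + 2) → ℕ) : Fin (k + 1) → ℕ := fun t => a t.succ

/-- The sign `(-1)^{a_0 + a_2 + a_4 + ⋯}`. -/
def evenSign {k : ℕ} (a : Fin (k + 2) → ℕ) : ℤ :=
  ∏ j : Fin (k + 2), if (j : ℕ) % 2 = 0 then (-1) ^ a j else 1

/-- Sequences of degrees in `[0, n]` starting with `0` and ending with `n`. -/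
def degSeqs (k n : ℕ) : Finset (Fin (k + 2) → ℕ) :=
  (Fintype.piFinset fun _ => Finset.range (n + 1)).filter
    fun a => a 0 = 0 ∧ a (Fin.last (k + 1)) = n

lemma mem_degSeqs {k n : ℕ} {a : Fin (k + 2) → ℕ} :
    a ∈ degSeqs k n ↔ (∀ i, a i ≤ n) ∧ a 0 = 0 ∧ a (Fin.last (k + 1)) = n := by
  simp [degSeqs]

/-- The chain `z` written as a sum over degree sequences. -/
noncomputable def degChain (k n : ℕ) : (Fin (k + 1) → ℕ) →₀ ℤ :=
  ∑ a ∈ degSeqs k n, evenSign a • tensorMul (k + 1) (leftDeg n a) (rightDeg a)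

lemma neg_one_pow_sub {n x : ℕ} (hn : Even n) (hx : x ≤ n) : (-1 : ℤ) ^ (n - x) = (-1) ^ x := by
  rw [neg_one_pow_eq_pow_mod_two, neg_one_pow_eq_pow_mod_two (n := x)]
  obtain ⟨j, rfl⟩ := hn
  congr 1
  omega

lemma dSign_succ (k : ℕ) (w : Fin (k + 1) → ℕ) (t : Fin k) :
    dSign (k + 1) w t.succ = dSign (k + 1) w t.castSucc * (-1) ^ w t.castSucc := by
  have h : Finset.univ.filter (fun j => j < t.succ) =
      insert t.castSucc (Finset.univ.filter (fun j => j < t.castSucc)) := by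
    ext j
    simp only [Finset.mem_filter, Finset.mem_univ, true_and, Finset.mem_insert, Fin.ext_iff,
      Fin.lt_def, Fin.val_succ, Fin.val_castSucc]
    omega
  rw [dSign, h, Finset.sum_insert (by simp), dSign]
  ring

lemma dSign_leftDeg_add_rightDeg {k n : ℕ} (hn : Even n) {a : Fin (k + 2) → ℕ}
    (ha : a ∈ degSeqs k n) (t : Fin (k + 1)) :
    dSign (k + 1) (leftDeg n a + rightDeg a) t = (-1) ^ a t.castSucc := by
  obtain ⟨hle, h0, -⟩ := mem_degSeqs.mp ha
  induction t using Fin.induction with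
  | zero => simp [dSign, h0]
  | succ t ih =>
    rw [dSign_succ, ih, Pi.add_apply, leftDeg, rightDeg, pow_add, neg_one_pow_sub hn (hle _),
      ← mul_assoc, ← pow_add, Even.neg_one_pow ⟨_, rfl⟩, one_mul, Fin.castSucc_succ]

lemma evenSign_update {k : ℕ} (a : Fin (k + 2) → ℕ) (j : Fin (k + 2)) (x : ℕ) :
    evenSign (Function.update a j x) = (if (j : ℕ) % 2 = 0 then (-1) ^ x else 1) *
      ∏ i ∈ Finset.univ.erase j, if (i : ℕ) % 2 = 0 then (-1) ^ a i else 1 := by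
  rw [evenSign, ← Finset.mul_prod_erase _ _ (Finset.mem_univ j), Function.update_self]
  congr 1
  refine Finset.prod_congr rfl fun i hi => ?_
  rw [Function.update_of_ne (Finset.ne_of_mem_erase hi)]

lemma evenSign_mul_partialCoeff {k n : ℕ} (hn : Even n) (a : Fin (k + 2) → ℕ) (i : Fin k) (x : ℕ)
    (hx : x < n) :
    evenSign (Function.update a i.castSucc.succ (x + 1)) * partialCoeff i (x + 1) =
      -(evenSign (Function.update a i.castSucc.succ x) * (-1) ^ x *
        partialCoeff (i + 1) (n - x)) := by
  rw [evenSign_update, evenSign_update]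
  generalize (∏ j ∈ Finset.univ.erase i.castSucc.succ,
    if (j : ℕ) % 2 = 0 then (-1 : ℤ) ^ a j else 1) = c
  have hnx : n - x ≠ 0 := by omega
  have hi : (i.castSucc.succ : ℕ) = i + 1 := rfl
  have hev : Even (n - x) ↔ Even x := by simp [Nat.even_sub hx.le, hn]
  rw [hi]
  rcases Nat.mod_two_eq_zero_or_one i with h | h
  · have h' : ((i : ℕ) + 1) % 2 ≠ 0 := by omega
    rcases Nat.even_or_odd x with hxe | hxo
    · have := hxe.add_one
      simp [partialCoeff, h, h', hxe, hev, hnx, this]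
    · have := hxo.add_one
      simp [partialCoeff, h, h', hev, ← Nat.not_even_iff_odd, this, Nat.not_even_iff_odd.mpr hxo]
  · have h' : ((i : ℕ) + 1) % 2 = 0 := by omega
    rcases Nat.even_or_odd x with hxe | hxo
    · have := hxe.add_one
      simp [partialCoeff, h, h', hxe, hev, ← Nat.not_even_iff_odd, Nat.not_even_iff_odd.mpr this]
    · have := hxo.add_one
      simp [partialCoeff, h, h', hev, hxo, ← Nat.not_even_iff_odd, this,
        Nat.not_even_iff_odd.mpr hxo]

lemma sum_partial_left_add_sum_partial_right {k n : ℕ} (hn : Even n) (i : Fin k) :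
    ∑ a ∈ degSeqs k n, (evenSign a * partialCoeff i (a i.castSucc.succ)) •
        tensorMul (k + 1) (leftDeg n a)
          (Function.update (rightDeg a) i.castSucc (rightDeg a i.castSucc - 1)) +
      ∑ a ∈ degSeqs k n, (evenSign a * (-1) ^ a i.castSucc.succ *
          partialCoeff (i + 1) (n - a i.castSucc.succ)) •
        tensorMul (k + 1) (Function.update (leftDeg n a) i.succ (leftDeg n a i.succ - 1))
          (rightDeg a) = 0 := by
  rw [← eq_neg_iff_add_eq_zero, ← Finset.sum_neg_distrib]
  rw [← Finset.sum_filter_of_ne (p := fun a => a i.castSucc.succ ≠ 0),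
    ← Finset.sum_filter_of_ne (s := degSeqs k n) (f := fun a => -_)
      (p := fun a => a i.castSucc.succ ≠ n)]
  rotate_left
  · intro a _ h ha
    simp [ha, partialCoeff_zero] at h
  · intro a _ h ha
    simp [ha, partialCoeff_zero] at h
  have hne0 : (0 : Fin (k + 2)) ≠ i.castSucc.succ := by simp [Fin.ext_iff]
  have hnel : Fin.last (k + 1) ≠ i.castSucc.succ := by
    have := i.isLt
    simp [Fin.ext_iff]; omega
  refine Finset.sum_nbij' (fun a => Function.update a i.castSucc.succ (a i.castSucc.succ - 1))
    (fun a => Function.update a i.castSucc.succ (a i.castSucc.succ + 1)) ?_ ?_ ?_ ?_ ?_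
  · intro a ha
    simp only [Finset.mem_filter, mem_degSeqs] at ha ⊢
    obtain ⟨⟨hle, h0, hl⟩, hp⟩ := ha
    have := hle i.castSucc.succ
    refine ⟨⟨fun j => ?_, ?_, ?_⟩, ?_⟩
    · rcases eq_or_ne j i.castSucc.succ with rfl | hj
      · simp only [Function.update_self]; omega
      · rw [Function.update_of_ne hj]; exact hle j
    · rw [Function.update_of_ne hne0, h0]
    · rw [Function.update_of_ne hnel, hl]
    · simp only [Function.update_self]; omega
  · intro a ha
    simp only [Finset.mem_filter, mem_degSeqs] at ha ⊢
    obtain ⟨⟨hle, h0, hl⟩, hp⟩ := ha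
    have := hle i.castSucc.succ
    refine ⟨⟨fun j => ?_, ?_, ?_⟩, ?_⟩
    · rcases eq_or_ne j i.castSucc.succ with rfl | hj
      · simp only [Function.update_self]; omega
      · rw [Function.update_of_ne hj]; exact hle j
    · rw [Function.update_of_ne hne0, h0]
    · rw [Function.update_of_ne hnel, hl]
    · simp only [Function.update_self]; omega
  · intro a ha
    have := (Finset.mem_filter.mp ha).2
    simp [Nat.sub_add_cancel (Nat.one_le_iff_ne_zero.mpr this)]
  · intro a ha
    simp
  · intro a ha
    simp only [Finset.mem_filter, mem_degSeqs] at ha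
    obtain ⟨⟨hle, h0, hl⟩, hp⟩ := ha
    have hlt := hle i.castSucc.succ
    obtain ⟨x, hx⟩ := Nat.exists_eq_succ_of_ne_zero hp
    have hkey := evenSign_mul_partialCoeff hn a i x (by omega)
    simp only [← Nat.succ_eq_add_one] at hkey
    rw [← hx, Function.update_eq_self] at hkey
    have hL : leftDeg n a = Function.update
        (leftDeg n (Function.update a i.castSucc.succ (a i.castSucc.succ - 1))) i.succ
        (leftDeg n (Function.update a i.castSucc.succ (a i.castSucc.succ - 1)) i.succ - 1) := by
      ext j
      rcases eq_or_ne j i.succ with rfl | hj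
      · simp only [leftDeg, Fin.castSucc_succ, Function.update_self]; omega
      · have : j.castSucc ≠ i.castSucc.succ := fun h => hj (Fin.castSucc_injective _ h)
        simp [leftDeg, hj, this]
    have hR : Function.update (rightDeg a) i.castSucc (rightDeg a i.castSucc - 1) =
        rightDeg (Function.update a i.castSucc.succ (a i.castSucc.succ - 1)) := by
      ext j
      rcases eq_or_ne j i.castSucc with rfl | hj
      · simp [rightDeg]
      · have : j.succ ≠ i.castSucc.succ := fun h => hj (Fin.succ_injective _ h)
        simp [rightDeg, hj, this]
    rw [← hL, hR, ← neg_smul]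
    simp only [Function.update_self, hx, Nat.succ_eq_add_one, Nat.add_sub_cancel] at hkey ⊢
    rw [← hkey]

lemma bd_degChain {k n : ℕ} (hk : Even k) (hn : Even n) : bd (k + 1) (degChain k n) = 0 := by
  have hterm : ∀ a ∈ degSeqs k n,
      bd (k + 1) (evenSign a • tensorMul (k + 1) (leftDeg n a) (rightDeg a)) =
      ∑ i : Fin k, ((evenSign a * partialCoeff i (a i.castSucc.succ)) •
          tensorMul (k + 1) (leftDeg n a)
            (Function.update (rightDeg a) i.castSucc (rightDeg a i.castSucc - 1)) +
        (evenSign a * (-1) ^ a i.castSucc.succ *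
            partialCoeff (i + 1) (n - a i.castSucc.succ)) •
          tensorMul (k + 1) (Function.update (leftDeg n a) i.succ (leftDeg n a i.succ - 1))
            (rightDeg a)) := by
    intro a ha
    obtain ⟨hle, h0, hl⟩ := mem_degSeqs.mp ha
    have hs (t : Fin (k + 1)) : (-1 : ℤ) ^ leftDeg n a t = (-1) ^ a t.castSucc :=
      neg_one_pow_sub hn (hle _)
    have hsq (x : ℕ) : (-1 : ℤ) ^ x * (-1) ^ x = 1 := by
      rw [← pow_add, Even.neg_one_pow ⟨_, rfl⟩]
    have hfirst : partialCoeff ((0 : Fin (k + 1)) : ℕ) (leftDeg n a 0) = 0 := by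
      simp [partialCoeff, leftDeg, h0, hn]
    have hlast : partialCoeff (Fin.last k : ℕ) (rightDeg a (Fin.last k)) = 0 := by
      simp [partialCoeff, rightDeg, hl, hn, Nat.even_iff.mp hk]
    simp only [map_smul, bd_tensorMul, dSign_leftDeg_add_rightDeg hn ha, hs, smul_add,
      Finset.sum_add_distrib]
    rw [Fin.sum_univ_succ, Fin.sum_univ_castSucc (n := k)
        (f := fun t => _ • ((-1) ^ a t.castSucc • _ • _)), hfirst, hlast]
    simp only [zero_smul, smul_zero, zero_add, add_zero, Finset.smul_sum, smul_smul]
    refine (add_comm _ _).trans ?_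
    congr 1
    · refine Finset.sum_congr rfl fun i _ => ?_
      simp only [← mul_assoc]
      rw [mul_assoc (evenSign a), hsq, mul_one]
      rfl
    · simp only [← mul_assoc]
      rfl
  rw [degChain, map_sum, Finset.sum_congr rfl hterm, Finset.sum_comm]
  refine Finset.sum_eq_zero fun i _ => ?_
  rw [Finset.sum_add_distrib, sum_partial_left_add_sum_partial_right hn]

lemma even_choose_of_two_pow_le {r k l : ℕ} (hk : k < 2 ^ r) (hl : l < 2 ^ r)
    (h : 2 ^ r ≤ k + l) : Even ((k + l).choose l) := by
  have hr : r ≠ 0 := by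
    rintro rfl
    omega
  have hf := Nat.factorization_choose' (p := 2) (n := k) (k := l) (b := Nat.log 2 (k + l) + 1)
    Nat.prime_two (Nat.lt_succ_self (Nat.log 2 (k + l)))
  rw [even_iff_two_dvd]
  by_contra hd
  rw [Nat.factorization_eq_zero_of_not_dvd hd, eq_comm, Finset.card_eq_zero,
    Finset.filter_eq_empty_iff] at hf
  refine hf (x := r) (Finset.mem_Ico.mpr ⟨by omega, ?_⟩) ?_
  · exact Nat.lt_succ_of_le (Nat.le_log_of_pow_le one_lt_two h)
  · rw [Nat.mod_eq_of_lt hk, Nat.mod_eq_of_lt hl]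
    omega

lemma even_mulCoeff {r b a : ℕ} (hb : b < 2 ^ (r + 1)) (ha : a < 2 ^ (r + 1))
    (h : 2 ^ (r + 1) ≤ b + a) : Even (mulCoeff b a) := by
  rw [pow_succ] at *
  unfold mulCoeff
  split_ifs with ho
  · exact Even.zero
  · rw [Int.even_coe_nat]
    refine even_choose_of_two_pow_le (r := r) (by omega) (by omega) ?_
    rw [Nat.odd_iff, Nat.odd_iff] at ho
    omega

lemma even_prod_mulCoeff {r k : ℕ} (hk : k + 2 ≤ 2 ^ (r + 1) - 2) {a : Fin (k + 2) → ℕ}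
    (ha : a ∈ degSeqs k (2 ^ (r + 1) - 2)) :
    Even (∏ t, mulCoeff (leftDeg (2 ^ (r + 1) - 2) a t) (rightDeg a t)) := by
  obtain ⟨hle, h0, hl⟩ := mem_degSeqs.mp ha
  by_contra hodd
  have hstep (t : Fin (k + 1)) : a t.succ ≤ a t.castSucc + 1 := by
    by_contra! hlt
    refine hodd (Even.trans_dvd (?_ : Even (mulCoeff (leftDeg (2 ^ (r + 1) - 2) a t) (rightDeg a t)))
      (Finset.dvd_prod_of_mem (fun t => mulCoeff (leftDeg (2 ^ (r + 1) - 2) a t) (rightDeg a t))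
        (Finset.mem_univ t)))
    have h1 := hle t.castSucc
    have h2 := hle t.succ
    exact even_mulCoeff (r := r) (by simp only [leftDeg]; omega) (by simp only [rightDeg]; omega)
      (by simp only [leftDeg, rightDeg]; omega)
  have hbound (j : Fin (k + 2)) : a j ≤ j := by
    induction j using Fin.induction with
    | zero => simp [h0]
    | succ t ih =>
      have := hstep t
      simp only [Fin.val_succ, Fin.val_castSucc] at *
      omega
  have := hbound (Fin.last (k + 1))
  simp only [hl, Fin.val_last] at this
  omega

lemma exists_degChain_eq_two_smul {r k : ℕ} (hk : k + 2 ≤ 2 ^ (r + 1) - 2) :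
    ∃ y, degChain k (2 ^ (r + 1) - 2) = (2 : ℤ) • y := by
  suffices h : degChain k (2 ^ (r + 1) - 2) ∈
      LinearMap.range ((2 : ℤ) • (LinearMap.id : ((Fin (k + 1) → ℕ) →₀ ℤ) →ₗ[ℤ] _)) by
    obtain ⟨y, hy⟩ := h
    exact ⟨y, hy.symm⟩
  refine Submodule.sum_mem _ fun a ha => Submodule.smul_mem _ _ ?_
  obtain ⟨c, hc⟩ := (even_prod_mulCoeff hk ha).two_dvd
  refine ⟨Finsupp.single (leftDeg (2 ^ (r + 1) - 2) a + rightDeg a) c, ?_⟩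
  simp [tensorMul, hc]

/-- The degree sequence `a_i = 2 p_i + δ_i` of a summation index of `zchain`. -/
def seqOf (k m : ℕ) (x : Fin k → Fin 2 × Fin (m + 1)) : Fin (k + 2) → ℕ := fun j =>
  if (j : ℕ) = 0 then 0 else if (j : ℕ) = k + 1 then 2 * m
  else 2 * pOf (k + 2) m x j + dOf (k + 2) m x j

/-- The summation index of `zchain` corresponding to a degree sequence. -/
def idxOf (k m : ℕ) (a : Fin (k + 2) → ℕ) : Fin k → Fin 2 × Fin (m + 1) := fun i =>
  (Fin.ofNat 2 (a i.castSucc.succ), Fin.ofNat (m + 1) (a i.castSucc.succ / 2))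

section seqOf

variable {k m : ℕ} {x : Fin k → Fin 2 × Fin (m + 1)}

lemma dOf_le_one (x : Fin k → Fin 2 × Fin (m + 1)) (i : ℕ) : dOf (k + 2) m x i ≤ 1 := by
  unfold dOf
  split_ifs with h
  · exact Nat.lt_succ_iff.mp (x ⟨i - 1, by omega⟩).1.isLt
  · exact zero_le_one

lemma pOf_add_dOf_le (hx : zpred (k + 2) m x) {i : ℕ} (h1 : 1 ≤ i) (hi : i ≤ k) (hm : m ≠ 0) :
    pOf (k + 2) m x i + dOf (k + 2) m x i ≤ m := by
  have h := hx.2 i (Finset.mem_Icc.mpr ⟨h1, hi⟩)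
  have hd := dOf_le_one x i
  omega

lemma dOf_idxOf (a : Fin (k + 2) → ℕ) (i : Fin k) :
    dOf (k + 2) m (idxOf k m a) (i + 1) = a i.castSucc.succ % 2 := by
  have h : 1 ≤ (i : ℕ) + 1 ∧ (i : ℕ) + 1 ≤ k + 2 - 2 := ⟨by omega, i.isLt⟩
  rw [dOf, dif_pos h]
  rfl

lemma pOf_idxOf {a : Fin (k + 2) → ℕ} (i : Fin k) (ha : a i.castSucc.succ ≤ 2 * m) :
    pOf (k + 2) m (idxOf k m a) (i + 1) = a i.castSucc.succ / 2 := by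
  have h : 1 ≤ (i : ℕ) + 1 ∧ (i : ℕ) + 1 ≤ k + 2 - 2 := ⟨by omega, i.isLt⟩
  rw [pOf, dif_pos h]
  exact (Nat.mod_eq_of_lt (by omega) : a i.castSucc.succ / 2 % (m + 1) = _)

lemma seqOf_zero : seqOf k m x 0 = 0 := rfl

lemma seqOf_last : seqOf k m x (Fin.last (k + 1)) = 2 * m := by
  simp [seqOf]

lemma seqOf_mid (i : Fin k) :
    seqOf k m x i.castSucc.succ =
      2 * pOf (k + 2) m x (i + 1) + dOf (k + 2) m x (i + 1) := by
  have : (i : ℕ) ≠ k := i.isLt.ne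
  simp [seqOf, this]

lemma forall_fin_add_two {P : Fin (k + 2) → Prop} (h0 : P 0) (hl : P (Fin.last (k + 1)))
    (hm : ∀ i : Fin k, P i.castSucc.succ) (j : Fin (k + 2)) : P j := by
  induction j using Fin.cases with
  | zero => exact h0
  | succ j =>
    induction j using Fin.lastCases with
    | last => exact hl
    | cast i => exact hm i

lemma seqOf_idxOf {a : Fin (k + 2) → ℕ} (ha : a ∈ degSeqs k (2 * m)) :
    seqOf k m (idxOf k m a) = a := by
  obtain ⟨hle, h0, hl⟩ := mem_degSeqs.mp ha
  ext j
  induction j using forall_fin_add_two with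
  | h0 => rw [seqOf_zero, h0]
  | hl => rw [seqOf_last, hl]
  | hm i =>
    rw [seqOf_mid, dOf_idxOf, pOf_idxOf i (hle _)]
    omega

lemma idxOf_seqOf (x : Fin k → Fin 2 × Fin (m + 1)) : idxOf k m (seqOf k m x) = x := by
  have hp (i : Fin k) : pOf (k + 2) m x (i + 1) = (x i).2 :=
    dif_pos (⟨by omega, i.isLt⟩ : 1 ≤ (i : ℕ) + 1 ∧ (i : ℕ) + 1 ≤ k + 2 - 2)
  have hd (i : Fin k) : dOf (k + 2) m x (i + 1) = (x i).1 :=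
    dif_pos (⟨by omega, i.isLt⟩ : 1 ≤ (i : ℕ) + 1 ∧ (i : ℕ) + 1 ≤ k + 2 - 2)
  funext i
  have h1 := (x i).1.isLt
  have h2 := (x i).2.isLt
  refine Prod.ext (Fin.ext ?_) (Fin.ext ?_)
  · change seqOf k m x i.castSucc.succ % 2 = _
    rw [seqOf_mid, hp, hd]
    omega
  · change seqOf k m x i.castSucc.succ / 2 % (m + 1) = _
    rw [seqOf_mid, hp, hd, Nat.mod_eq_of_lt] <;> omega

lemma seqOf_mem_degSeqs (hx : zpred (k + 2) m x) (hm : m ≠ 0) :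
    seqOf k m x ∈ degSeqs k (2 * m) := by
  refine mem_degSeqs.mpr ⟨fun j => ?_, seqOf_zero, seqOf_last⟩
  induction j using forall_fin_add_two with
  | h0 => simp [seqOf_zero]
  | hl => rw [seqOf_last]
  | hm i =>
    have := pOf_add_dOf_le hx (i := i + 1) (by omega) i.isLt hm
    rw [seqOf_mid]
    omega

lemma zpred_idxOf {a : Fin (k + 2) → ℕ} (ha : a ∈ degSeqs k (2 * m))
    (hodd : ∀ t, ¬(Odd (leftDeg (2 * m) a t) ∧ Odd (rightDeg a t))) :
    zpred (k + 2) m (idxOf k m a) := by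
  obtain ⟨hle, h0, hl⟩ := mem_degSeqs.mp ha
  refine ⟨fun i hi => ?_, fun i hi => ?_⟩
  · obtain ⟨h1, h2⟩ := Finset.mem_Icc.mp hi
    have h2' : i < k := by omega
    have e1 := dOf_idxOf (m := m) a ⟨i - 1, by omega⟩
    have e2 := dOf_idxOf (m := m) a ⟨i, h2'⟩
    simp only [Nat.sub_add_cancel h1] at e1
    rw [e1, e2]
    have h := hodd ⟨i, by omega⟩
    have hj : (⟨i, h2'⟩ : Fin k).castSucc.castSucc = (⟨i - 1, by omega⟩ : Fin k).castSucc.succ :=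
      Fin.ext (Nat.sub_add_cancel h1).symm
    change ¬(Odd (2 * m - a (⟨i, h2'⟩ : Fin k).castSucc.castSucc) ∧
      Odd (a (⟨i, h2'⟩ : Fin k).castSucc.succ)) at h
    rw [hj] at h
    have := hle (⟨i - 1, by omega⟩ : Fin k).castSucc.succ
    rw [Nat.odd_iff, Nat.odd_iff] at h
    rw [mul_eq_zero]
    omega
  · obtain ⟨h1, h2⟩ := Finset.mem_Icc.mp hi
    have h2' : i ≤ k := h2
    have e1 := dOf_idxOf (m := m) a ⟨i - 1, by omega⟩
    have e2 := pOf_idxOf (m := m) (a := a) ⟨i - 1, by omega⟩ (hle _)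
    have := hle (⟨i - 1, by omega⟩ : Fin k).castSucc.succ
    simp only [Nat.sub_add_cancel h1] at e1 e2
    rw [qOf, e1, e2]
    omega

lemma leftDeg_seqOf_zero : leftDeg (2 * m) (seqOf k m x) 0 = 2 * m := by
  simp [leftDeg, seqOf_zero]

lemma leftDeg_seqOf_succ (hx : zpred (k + 2) m x) (hm : m ≠ 0) (i : Fin k) :
    leftDeg (2 * m) (seqOf k m x) i.succ =
      2 * qOf (k + 2) m x (i + 1) + dOf (k + 2) m x (i + 1) := by
  have h := pOf_add_dOf_le hx (i := i + 1) (by omega) i.isLt hm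
  rw [leftDeg, Fin.castSucc_succ, seqOf_mid, qOf]
  omega

lemma rightDeg_seqOf_last : rightDeg (seqOf k m x) (Fin.last k) = 2 * m := seqOf_last

lemma rightDeg_seqOf_castSucc (i : Fin k) :
    rightDeg (seqOf k m x) i.castSucc =
      2 * pOf (k + 2) m x (i + 1) + dOf (k + 2) m x (i + 1) := seqOf_mid i

lemma mulCoeff_two_mul_add {p q d e : ℕ} (hd : d ≤ 1) (he : e ≤ 1) (h : d * e = 0) :
    mulCoeff (2 * q + d) (2 * p + e) = (q + p).choose p := by
  have h1 : (2 * q + d) / 2 = q := by omega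
  have h2 : (2 * p + e) / 2 = p := by omega
  rw [mulCoeff, if_neg, h1, h2]
  rw [Nat.odd_iff, Nat.odd_iff]
  rw [mul_eq_zero] at h
  omega

lemma not_odd_and_odd_seqOf (hx : zpred (k + 2) m x) (hm : m ≠ 0) (t : Fin (k + 1)) :
    ¬(Odd (leftDeg (2 * m) (seqOf k m x) t) ∧ Odd (rightDeg (seqOf k m x) t)) := by
  rw [Nat.odd_iff, Nat.odd_iff]
  induction t using Fin.cases with
  | zero => rw [leftDeg_seqOf_zero]; omega
  | succ i =>
    rw [leftDeg_seqOf_succ hx hm]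
    rcases Nat.eq_or_lt_of_le (Nat.succ_le_of_lt i.isLt) with hi | hi
    · have : i.succ = Fin.last k := Fin.ext hi
      rw [this, rightDeg_seqOf_last]
      omega
    · have : i.succ = (⟨i + 1, hi⟩ : Fin k).castSucc := rfl
      rw [this, rightDeg_seqOf_castSucc]
      have h := hx.1 (i + 1) (Finset.mem_Icc.mpr ⟨by omega, by omega⟩)
      rw [mul_eq_zero] at h
      simp only
      omega

lemma prod_mulCoeff_seqOf (hk : k ≠ 0) (hm : m ≠ 0) (hx : zpred (k + 2) m x) :
    ∏ t, mulCoeff (leftDeg (2 * m) (seqOf k m x) t) (rightDeg (seqOf k m x) t) =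
      coefOf (k + 2) m x := by
  obtain ⟨l, rfl⟩ := Nat.exists_eq_succ_of_ne_zero hk
  have hfirst := rightDeg_seqOf_castSucc (x := x) 0
  rw [Fin.castSucc_zero] at hfirst
  have hlast := leftDeg_seqOf_succ hx hm (Fin.last l)
  have hd := dOf_le_one x
  have hmid (i : Fin l) : mulCoeff (leftDeg (2 * m) (seqOf (l + 1) m x) i.castSucc.succ)
      (rightDeg (seqOf (l + 1) m x) i.castSucc.succ) =
      ((qOf (l + 3) m x (i + 1) + pOf (l + 3) m x (i + 1 + 1)).choose
        (pOf (l + 3) m x (i + 1 + 1)) : ℕ) := by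
    rw [leftDeg_seqOf_succ hx hm, ← Fin.castSucc_succ, rightDeg_seqOf_castSucc]
    refine mulCoeff_two_mul_add (hd _) (hd _) (hx.1 _ (Finset.mem_Icc.mpr ⟨by simp, ?_⟩))
    have := i.isLt
    simp only [Fin.val_castSucc]
    omega
  rw [Fin.prod_univ_succ, Fin.prod_univ_castSucc, leftDeg_seqOf_zero, hfirst, hlast,
    Fin.succ_last, rightDeg_seqOf_last, Finset.prod_congr rfl fun i _ => hmid i, coefOf]
  have e1 := mulCoeff_two_mul_add (q := m) (p := pOf (l + 1 + 2) m x 1) zero_le_one (hd 1)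
    (zero_mul _)
  have e2 := mulCoeff_two_mul_add (q := qOf (l + 1 + 2) m x (l + 1)) (p := m) (hd (l + 1))
    zero_le_one (mul_zero _)
  simp only [add_zero] at e1 e2
  have e3 : ∏ i ∈ Finset.Icc 1 (l + 1 + 2 - 3),
      (qOf (l + 1 + 2) m x i + pOf (l + 1 + 2) m x (i + 1)).choose (pOf (l + 1 + 2) m x (i + 1)) =
      ∏ i : Fin l, (qOf (l + 3) m x (i + 1) + pOf (l + 3) m x (i + 1 + 1)).choose
        (pOf (l + 3) m x (i + 1 + 1)) := by
    rw [Fin.prod_univ_eq_prod_range (fun i => (qOf (l + 3) m x (i + 1) +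
      pOf (l + 3) m x (i + 1 + 1)).choose (pOf (l + 3) m x (i + 1 + 1))) l,
      Finset.range_eq_Ico, Finset.prod_Ico_add' (fun i => (qOf (l + 3) m x i +
      pOf (l + 3) m x (i + 1)).choose (pOf (l + 3) m x (i + 1))) 0 l 1]
    rfl
  simp only [Fin.val_zero, zero_add, Fin.val_last, Nat.succ_eq_add_one] at *
  rw [e1, e2, e3]
  push_cast
  rw [mul_assoc]

lemma evenSign_seqOf (x : Fin k → Fin 2 × Fin (m + 1)) :
    evenSign (seqOf k m x) = signOf (k + 2) m x := by
  have hpow (i : Fin k) : (-1 : ℤ) ^ seqOf k m x i.castSucc.succ =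
      (-1) ^ dOf (k + 2) m x (i + 1) := by
    rw [seqOf_mid, pow_add, pow_mul]
    simp
  rw [evenSign, Fin.prod_univ_succ, Fin.prod_univ_castSucc, Fin.succ_last, seqOf_last, seqOf_zero,
    signOf, ← Finset.prod_pow_eq_pow_sum, Finset.prod_filter]
  simp only [hpow, pow_zero, ite_self, one_mul, pow_mul, even_two.neg_one_pow, one_pow, mul_one]
  change ∏ i : Fin k, (if ((i : ℕ) + 1) % 2 = 0 then (-1 : ℤ) ^ dOf (k + 2) m x (i + 1) else 1) = _
  rw [Fin.prod_univ_eq_prod_range (fun i => if (i + 1) % 2 = 0 then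
      (-1 : ℤ) ^ dOf (k + 2) m x (i + 1) else 1) k, Finset.range_eq_Ico,
    Finset.prod_Ico_add' (fun i => if i % 2 = 0 then (-1 : ℤ) ^ dOf (k + 2) m x i else 1) 0 k 1]
  rfl

lemma leftDeg_add_rightDeg_seqOf (hk : k ≠ 0) (hm : m ≠ 0) (hx : zpred (k + 2) m x) :
    leftDeg (2 * m) (seqOf k m x) + rightDeg (seqOf k m x) =
      fun i : Fin (k + 1) => wOf (k + 2) m x (i + 1) := by
  ext t
  rw [Pi.add_apply, wOf]
  have hk' : k + 2 - 1 = k + 1 := rfl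
  have hk'' : k + 2 - 2 = k := rfl
  rw [hk', hk'']
  have hR : rightDeg (seqOf k m x) t = if (t : ℕ) = k then 2 * m else
      2 * pOf (k + 2) m x (t + 1) + dOf (k + 2) m x (t + 1) := by
    induction t using Fin.lastCases with
    | last => simp [rightDeg_seqOf_last]
    | cast i => simp [rightDeg_seqOf_castSucc, i.isLt.ne]
  rw [hR]
  induction t using Fin.cases with
  | zero =>
    rw [leftDeg_seqOf_zero]
    simp [hk.symm]
    ring
  | succ i =>
    rw [leftDeg_seqOf_succ hx hm]
    simp only [Fin.val_succ, Nat.add_sub_cancel]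
    split_ifs with h1 h2 h3 h4
    · omega
    · rw [h1]
      ring
    · omega
    · omega
    · omega
    · ring

end seqOf

lemma zchain_eq_degChain {k m : ℕ} (hk : k ≠ 0) (hm : m ≠ 0) :
    zchain (k + 2) m = degChain k (2 * m) := by
  have hsupp : ∀ a ∈ degSeqs k (2 * m),
      evenSign a • tensorMul (k + 1) (leftDeg (2 * m) a) (rightDeg a) ≠ 0 →
      ∀ t, ¬(Odd (leftDeg (2 * m) a t) ∧ Odd (rightDeg a t)) := by
    intro a _ h t ht
    refine h ?_
    rw [tensorMul, Finset.prod_eq_zero (Finset.mem_univ t) (show mulCoeff _ _ = 0 from if_pos ht),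
      Finsupp.single_zero, smul_zero]
  rw [degChain, ← Finset.sum_filter_of_ne hsupp]
  refine Finset.sum_nbij' (seqOf k m) (idxOf k m) ?_ ?_ ?_ ?_ ?_
  · intro x hx
    have hx := (Finset.mem_filter.mp hx).2
    exact Finset.mem_filter.mpr ⟨seqOf_mem_degSeqs hx hm, not_odd_and_odd_seqOf hx hm⟩
  · intro a ha
    obtain ⟨ha, hodd⟩ := Finset.mem_filter.mp ha
    exact Finset.mem_filter.mpr ⟨Finset.mem_univ _, zpred_idxOf ha hodd⟩
  · intro x _
    exact idxOf_seqOf x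
  · intro a ha
    exact seqOf_idxOf (Finset.mem_filter.mp ha).1
  · intro x hx
    have hx := (Finset.mem_filter.mp hx).2
    rw [tensorMul, prod_mulCoeff_seqOf hk hm hx, evenSign_seqOf,
      leftDeg_add_rightDeg_seqOf hk hm hx, mul_smul, Finsupp.smul_single _ _ (1 : ℤ), smul_eq_mul,
      mul_one]
    rfl

/-- For `r ≥ 2`, `m = 2^r - 1`, `n = 2m = 2^{r+1} - 2`, and even `s` with `4 ≤ s ≤ n`,
the chain `z` (the chain-level representative of `χ_s∗(𝔪^{×s})`) lies in the image of the
differential `∂` of the free abelian group `D` on `ℕ^{s-1}`. -/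
theorem stmt14 (r : ℕ) (hr : 2 ≤ r) (s : ℕ) (hs4 : 4 ≤ s) (hse : Even s)
    (hsn : s ≤ 2 ^ (r + 1) - 2) :
    ∃ y : (Fin (s - 1) → ℕ) →₀ ℤ, bd (s - 1) y = zchain s (2 ^ r - 1) := by
  obtain ⟨k, rfl⟩ : ∃ k, s = k + 2 := ⟨s - 2, by omega⟩
  have hm : 2 * (2 ^ r - 1) = 2 ^ (r + 1) - 2 := by rw [pow_succ]; omega
  have h4 : 2 ^ 2 ≤ 2 ^ r := Nat.pow_le_pow_right two_pos hr
  rw [zchain_eq_degChain (by omega) (by omega), hm]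
  refine exists_bd_eq k _ (bd_degChain ?_ ?_) (exists_degChain_eq_two_smul hsn)
  · exact (Nat.even_add.mp hse).mpr even_two
  · rw [← hm]
    exact even_two_mul _
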